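/- Let ω ∈ T2.2, i.e., ω is a factor of F_∞ with f_k < n < f_{k+1} (n = |ω|) and sk(ω) = s_{k-1}. Then in the unique kernel decomposition ω = μ₁ s_{k-1} μ₂, there exists i with 0 ≤ i ≤ n − f_{k-1} such that μ₁ is the suffix of s_k of length i (μ₁ = s_k[f_k−i+1, f_k]) and μ₂ is the prefix of s_k of length n − f_{k-1} − i (μ₂ = s_k[1, n−f_{k-1}−i]). -/

import Mathlib

/-- Finite Fibonacci words: `Fw k = σ^k(a)` where `a = false`, `b = true`,
`σ(a) = ab`, `σ(b) = a`; so `Fw (k+2) = Fw (k+1) ++ Fw k`. -/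
def Fw : ℕ → List Bool
  | 0 => [false]
  | 1 => [false, true]
  | (k+2) => Fw (k+1) ++ Fw k

/-- The infinite Fibonacci word `F_∞` (0-indexed): since `Fw (n+1)` has length
`fib (n+3) > n`, its `n`-th letter is the `n`-th letter of `F_∞`. -/
def fw (n : ℕ) : Bool := (Fw (n+1)).getD n false

/-- Singular words, with index shifted by one: `sw n = s_{n-1}`.
`sw 0 = s_{-1} = a`, and `sw (n+1) = s_n = β_n · F_n · α_n⁻¹` where
`α_n` is the last letter of `F_n` and `β_n` the other letter. -/
def sw : ℕ → List Bool
  | 0 => [false]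
  | (n+1) => (!((Fw n).getLastD false)) :: (Fw n).dropLast

/-- The factor of `F_∞` of length `n` starting at (0-indexed) position `i`. -/
def seg (i n : ℕ) : List Bool := (List.range n).map (fun t => fw (i + t))

/-- `w` occurs in `F_∞` at (0-indexed) position `i`. -/
def OccursAt (w : List Bool) (i : ℕ) : Prop := seg i w.length = w

/-- `w` is a factor of `F_∞`. -/
def IsFactor (w : List Bool) : Prop := ∃ i, OccursAt w i

/-- Starting position of the `(p+1)`-st occurrence of `w` in `F_∞`
(occurrences enumerated by starting position, 0-indexed: `occPos w 0`
is the first occurrence, i.e. the paper's `ω_1`). -/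
noncomputable def occPos (w : List Bool) (p : ℕ) : ℕ := Nat.nth (OccursAt w) p

/-- A finite word viewed as an element of the free group on the alphabet. -/
def listToFree (w : List Bool) : FreeGroup Bool := (w.map FreeGroup.of).prod

/-- The gap `ν_{w,p}` (0-indexed in `p`: `gap w 0` is the paper's `ν_{w,1}`)
between the `(p+1)`-st and `(p+2)`-nd occurrences of `w`, as an element of the
free group: the separating word if the occurrences are separated or adjacent,
and the formal inverse of the overlap if they overlap. -/
noncomputable def gap (w : List Bool) (p : ℕ) : FreeGroup Bool :=
  if occPos w p + w.length ≤ occPos w (p+1) then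
    listToFree (seg (occPos w p + w.length) (occPos w (p+1) - (occPos w p + w.length)))
  else
    (listToFree (seg (occPos w (p+1)) (occPos w p + w.length - occPos w (p+1))))⁻¹

/-- The signed length `|ν_{w,p}|` of the gap (negative in the overlapped case). -/
noncomputable def gapLen (w : List Bool) (p : ℕ) : ℤ :=
  (occPos w (p+1) : ℤ) - ((occPos w p : ℤ) + (w.length : ℤ))

/-- `u` is a singular word (some `s_k`, `k ≥ -1`). -/
def IsSingular (u : List Bool) : Prop := ∃ n, u = sw n

/-- `u` is a singular kernel of `w`: a singular factor of `w` of maximal length. -/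
def IsKernelOf (u w : List Bool) : Prop :=
  IsSingular u ∧ u <:+: w ∧ ∀ v : List Bool, IsSingular v → v <:+: w → v.length ≤ u.length

/-- The excluded words `{ε, ab, ba, aba}`. -/
def excl : List (List Bool) := [[], [false, true], [true, false], [false, true, false]]

/-- The `i`-th conjugate `C_i(w)` (indices taken mod the length). -/
def conj (i : ℕ) (w : List Bool) : List Bool :=
  w.drop (i % w.length) ++ w.take (i % w.length)

/-- `sliceW u i j = u[i,j]`, the letters `i` through `j` of `u`, 1-indexed. -/
def sliceW (u : List Bool) (i j : ℕ) : List Bool := (u.take j).drop (i - 1)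

/-- The Fibonacci morphism `σ(a) = ab`, `σ(b) = a`, with `a = false` and `b = true`. -/
def fibMorphism : List Bool → List Bool
  | [] => []
  | false :: w => false :: true :: fibMorphism w
  | true :: w => false :: fibMorphism w

/-- `w` is a factor of some finite Fibonacci word. -/
def InFibLanguage (w : List Bool) : Prop := ∃ m, w <:+: Fw m

theorem fibMorphism_append (u v : List Bool) :
    fibMorphism (u ++ v) = fibMorphism u ++ fibMorphism v := by
  induction u with
  | nil => rfl
  | cons c u ih => cases c <;> simp [fibMorphism, ih]

theorem fibMorphism_Fw : ∀ m, fibMorphism (Fw m) = Fw (m + 1)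
  | 0 => rfl
  | 1 => rfl
  | (m + 2) => by
    rw [Fw, fibMorphism_append, fibMorphism_Fw (m + 1), fibMorphism_Fw m, ← Fw]

theorem fibMorphism_ne_true_cons (z r : List Bool) : fibMorphism z ≠ true :: r := by
  rcases z with _ | ⟨_ | _, z⟩ <;> simp [fibMorphism]

theorem fibMorphism_injective : Function.Injective fibMorphism := by
  intro u
  induction u with
  | nil => intro v h; rcases v with _ | ⟨_ | _, v⟩ <;> simp_all [fibMorphism]
  | cons c u ih =>
    intro v h
    rcases v with _ | ⟨_ | _, v⟩ <;> cases c <;> simp only [fibMorphism] at h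
    · simp at h
    · simp at h
    · simp only [List.cons.injEq, true_and] at h
      rw [ih h]
    · simp only [List.cons.injEq, true_and] at h
      exact absurd h (fibMorphism_ne_true_cons _ _)
    · simp only [List.cons.injEq, true_and] at h
      exact absurd h.symm (fibMorphism_ne_true_cons _ _)
    · simp only [List.cons.injEq, true_and] at h
      rw [ih h]

/-- In a `σ`-image every letter `a` starts a block. -/
theorem exists_cut_of_fibMorphism_eq {z x r : List Bool}
    (h : fibMorphism z = x ++ false :: r) :
    ∃ z₁ z₂, z = z₁ ++ z₂ ∧ x = fibMorphism z₁ ∧ fibMorphism z₂ = false :: r := by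
  induction z generalizing x with
  | nil => simp [fibMorphism] at h
  | cons c z ih =>
    rcases x with _ | ⟨d, x⟩
    · exact ⟨[], c :: z, rfl, rfl, h⟩
    cases c
    · rcases x with _ | ⟨e, x⟩
      · simp [fibMorphism] at h
      · simp only [fibMorphism, List.cons_append, List.cons.injEq] at h
        obtain ⟨rfl, rfl, h⟩ := h
        obtain ⟨z₁, z₂, rfl, rfl, hr⟩ := ih h
        exact ⟨false :: z₁, z₂, rfl, rfl, hr⟩
    · simp only [fibMorphism, List.cons_append, List.cons.injEq] at h
      obtain ⟨rfl, h⟩ := h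
      obtain ⟨z₁, z₂, rfl, rfl, hr⟩ := ih h
      exact ⟨true :: z₁, z₂, rfl, rfl, hr⟩

/-- In a `σ`-image every letter `b` ends a block `σ(a)`. -/
theorem exists_cut_of_fibMorphism_eq_true {z x r : List Bool}
    (h : fibMorphism z = x ++ true :: r) :
    ∃ z₁ z₂, z = z₁ ++ false :: z₂ ∧ fibMorphism z₂ = r := by
  induction z generalizing x with
  | nil => simp [fibMorphism] at h
  | cons c z ih =>
    rcases x with _ | ⟨d, x⟩
    · exact absurd h (fibMorphism_ne_true_cons _ _)
    cases c
    · rcases x with _ | ⟨e, x⟩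
      · simp only [fibMorphism, List.cons_append, List.nil_append, List.cons.injEq, true_and] at h
        exact ⟨[], z, rfl, h.2⟩
      · simp only [fibMorphism, List.cons_append, List.cons.injEq] at h
        obtain ⟨z₁, z₂, rfl, hr⟩ := ih h.2.2
        exact ⟨false :: z₁, z₂, rfl, hr⟩
    · simp only [fibMorphism, List.cons_append, List.cons.injEq] at h
      obtain ⟨z₁, z₂, rfl, hr⟩ := ih h.2
      exact ⟨true :: z₁, z₂, rfl, hr⟩

theorem exists_append_of_fibMorphism_eq {z s r : List Bool}
    (h : fibMorphism z = fibMorphism s ++ false :: r) :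
    ∃ z', z = s ++ z' ∧ fibMorphism z' = false :: r := by
  obtain ⟨z₁, z₂, rfl, hs, hr⟩ := exists_cut_of_fibMorphism_eq h
  exact ⟨z₂, by rw [fibMorphism_injective hs], hr⟩

theorem reverse_fibMorphism (w : List Bool) :
    false :: (fibMorphism w).reverse = fibMorphism w.reverse ++ [false] := by
  induction w with
  | nil => rfl
  | cons c w ih =>
    cases c <;> simp [fibMorphism, fibMorphism_append, ← List.cons_append, ih]

theorem InFibLanguage.of_infix {u w : List Bool} (hw : InFibLanguage w) (h : u <:+: w) :
    InFibLanguage u :=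
  hw.imp fun _ hm => h.trans hm

theorem InFibLanguage.fibMorphism {w : List Bool} (hw : InFibLanguage w) :
    InFibLanguage (fibMorphism w) := by
  obtain ⟨m, x, y, h⟩ := hw
  refine ⟨m + 1, _root_.fibMorphism x, _root_.fibMorphism y, ?_⟩
  rw [← fibMorphism_Fw, ← h, fibMorphism_append, fibMorphism_append]

theorem Fw_ne_nil : ∀ m, Fw m ≠ []
  | 0 => by simp [Fw]
  | 1 => by simp [Fw]
  | (m + 2) => by simp [Fw, Fw_ne_nil m]

theorem exists_Fw_succ_eq_append_cons : ∀ m, ∃ c y, Fw (m + 1) = Fw m ++ c :: y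
  | 0 => ⟨true, [], rfl⟩
  | (m + 1) => by
    obtain ⟨c, y, h⟩ := List.exists_cons_of_ne_nil (Fw_ne_nil m)
    exact ⟨c, y, by rw [Fw, h]⟩

theorem Fw_prefix_of_le {m n : ℕ} (h : m ≤ n) : Fw m <+: Fw n := by
  induction n, h using Nat.le_induction with
  | base => exact List.prefix_refl _
  | succ n _ ih =>
    obtain ⟨c, y, h⟩ := exists_Fw_succ_eq_append_cons n
    exact ih.trans ⟨c :: y, h.symm⟩

theorem InFibLanguage.exists_append_singleton {w : List Bool} (hw : InFibLanguage w) :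
    ∃ c, InFibLanguage (w ++ [c]) := by
  obtain ⟨m, x, y, h⟩ := hw
  obtain ⟨c, t, ht⟩ := exists_Fw_succ_eq_append_cons m
  rcases y with _ | ⟨d, y⟩
  · exact ⟨c, m + 1, x, t, by simp [ht, ← h]⟩
  · exact ⟨d, m, x, y, by simp [← h]⟩

theorem InFibLanguage.exists_preimage {w : List Bool} (hw : InFibLanguage w) :
    ∃ z, InFibLanguage z ∧ w <:+: _root_.fibMorphism z := by
  obtain ⟨m, h⟩ := hw
  refine ⟨Fw m, ⟨m, List.infix_rfl⟩, ?_⟩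
  rw [fibMorphism_Fw]
  exact h.trans (Fw_prefix_of_le m.le_succ).isInfix

theorem inFibLanguage_reverse_Fw (m : ℕ) : InFibLanguage (Fw m).reverse := by
  induction m with
  | zero => exact ⟨0, List.infix_rfl⟩
  | succ m ih =>
    obtain ⟨c, hc⟩ := ih.exists_append_singleton
    refine hc.fibMorphism.of_infix ?_
    obtain ⟨y, hy⟩ : ∃ y, fibMorphism [c] = false :: y := by
      cases c <;> simp [fibMorphism]
    refine ⟨[false], y, ?_⟩
    rw [fibMorphism_append, hy, ← fibMorphism_Fw, List.singleton_append, reverse_fibMorphism]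
    simp

theorem InFibLanguage.reverse {w : List Bool} (hw : InFibLanguage w) :
    InFibLanguage w.reverse := by
  obtain ⟨m, h⟩ := hw
  exact (inFibLanguage_reverse_Fw m).of_infix (List.reverse_infix.2 h)

theorem length_Fw : ∀ m, (Fw m).length = Nat.fib (m + 2)
  | 0 => rfl
  | 1 => rfl
  | (m + 2) => by
    rw [Fw, List.length_append, length_Fw (m + 1), length_Fw m, Nat.fib_add_two (n := m + 2)]
    ring

theorem length_sw (n : ℕ) : (sw n).length = Nat.fib (n + 1) := by
  cases n with
  | zero => rfl
  | succ n =>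
    have := List.length_pos_of_ne_nil (Fw_ne_nil n)
    rw [← length_Fw, sw, List.length_cons, List.length_dropLast]
    omega

theorem fw_eq_getElem {j m : ℕ} (h : j + 1 ≤ m) (hj : j < (Fw m).length) :
    fw j = (Fw m)[j] := by
  have hlen : j < (Fw (j + 1)).length := by
    rw [length_Fw]
    have : j + 3 ≤ Nat.fib (j + 1 + 2) + 1 := Nat.le_fib_add_one (j + 3)
    omega
  rw [fw, List.getD_eq_getElem _ _ hlen]
  exact (Fw_prefix_of_le h).getElem hlen

theorem inFibLanguage_of_isFactor {w : List Bool} (hw : IsFactor w) : InFibLanguage w := by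
  obtain ⟨i, hi⟩ := hw
  have hlen : i + w.length ≤ (Fw (i + w.length + 1)).length := by
    rw [length_Fw]
    have : i + w.length + 3 ≤ Nat.fib (i + w.length + 1 + 2) + 1 :=
      Nat.le_fib_add_one (i + w.length + 3)
    omega
  have h : w = ((Fw (i + w.length + 1)).drop i).take w.length := by
    apply List.ext_getElem
    · simp only [List.length_take, List.length_drop]
      omega
    · intro j h₁ h₂
      have : w[j] = fw (i + j) := by
        conv_lhs => rw [← List.getElem_of_eq hi (by simpa [seg] using h₁)]
        simp [seg]
      rw [this, fw_eq_getElem (m := i + w.length + 1) (by omega) (by omega)]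
      simp
  exact ⟨_, h ▸ ((List.take_prefix _ _).isInfix.trans (List.drop_suffix _ _).isInfix)⟩

/-- Consecutive singular words are related by the Fibonacci morphism, in a way that depends on
whether the shorter one ends with `a` or with `b`. -/
theorem sw_succ_cases (n : ℕ) :
    (∃ t q, sw n = t ++ [false] ∧ sw (n + 1) = true :: q ∧
      fibMorphism (sw n) = false :: sw (n + 1)) ∨
    (∃ t, sw n = t ++ [true] ∧ sw (n + 1) = fibMorphism (sw n) ++ [false]) := by
  induction n with
  | zero => exact .inl ⟨[], [], rfl, rfl, rfl⟩
  | succ n ih =>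
    obtain ⟨t, c, hF⟩ := (List.eq_nil_or_concat' (Fw n)).resolve_left (Fw_ne_nil n)
    have hF' : Fw (n + 1) = fibMorphism t ++ fibMorphism [c] := by
      rw [← fibMorphism_Fw, hF, fibMorphism_append]
    have hs : sw (n + 1) = (!c) :: t := by simp [sw, hF]
    rcases ih with ⟨t', q, h₁, h₂, h₃⟩ | ⟨t', h₁, h₂⟩
    · right
      obtain rfl : c = false := by
        rw [h₂] at hs
        simpa using (List.cons.inj hs).1
      refine ⟨(fibMorphism t' ++ [false]).tail, ?_, by rw [hs]; simp [sw, hF', fibMorphism]⟩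
      rw [h₁, fibMorphism_append] at h₃
      have := congrArg List.tail h₃
      rw [List.tail_cons] at this
      rw [← this]
      cases fibMorphism t' <;> simp [fibMorphism]
    · left
      obtain rfl : c = true := by
        rw [h₂, h₁] at hs
        rcases t' with _ | ⟨_ | _, t'⟩ <;> simp [fibMorphism] at hs <;> simp [hs]
      exact ⟨_, fibMorphism t, h₂, by simp [sw, hF', fibMorphism],
        by rw [hs]; simp [sw, hF', fibMorphism]⟩

theorem reverse_sw (n : ℕ) : (sw n).reverse = sw n := by
  induction n with
  | zero => rfl
  | succ n ih =>
    have h := reverse_fibMorphism (sw n)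
    rw [ih] at h
    rcases sw_succ_cases n with ⟨t, q, h₁, h₂, h₃⟩ | ⟨t, h₁, h₂⟩
    · rw [h₃] at h
      simpa using h
    · rw [h₂, List.reverse_append, ← h]
      rfl

theorem fibMorphism_prefix_or_prefix {z t : List Bool} (h : z <+: t ∨ t <+: z) :
    fibMorphism z <+: fibMorphism t ++ [false] ∨ fibMorphism t ++ [false] <+: fibMorphism z := by
  rcases h with ⟨y, rfl⟩ | ⟨y, rfl⟩
  · left
    rw [fibMorphism_append, List.append_assoc]
    exact List.prefix_append _ _
  · rw [fibMorphism_append]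
    rcases y with _ | ⟨_ | _, y⟩
    · left
      simp [fibMorphism]
    all_goals
      right
      simp [fibMorphism]

/-- Every factor starting with the singular word `sw n` continues with `sw (n + 1)`, except
possibly in the last letter of the latter. -/
theorem prefix_or_prefix_of_sw_append (n : ℕ) {u t : List Bool} {c : Bool}
    (ht : sw (n + 1) = t ++ [c]) (hu : InFibLanguage (sw n ++ u)) :
    u <+: t ∨ t <+: u := by
  induction n generalizing u t c with
  | zero =>
    right
    have := congrArg List.length ht
    rw [length_sw] at this
    simp_all
  | succ n ih =>
    obtain ⟨z, hz, x, y, hxy⟩ := hu.exists_preimage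
    rcases sw_succ_cases n with ⟨s, q, hs, hq, hσ⟩ | ⟨s, hs, hσ⟩
    · have h : fibMorphism z = x ++ true :: (q ++ u ++ y) := by
        rw [← hxy, hq]
        simp
      obtain ⟨z₁, z₂, rfl, hz₂⟩ := exists_cut_of_fibMorphism_eq_true h
      have hcut : fibMorphism (false :: z₂) = fibMorphism s ++ false :: true :: (u ++ y) := by
        have : fibMorphism s ++ [false, true] = false :: true :: q := by
          rw [← hq, ← hσ, hs, fibMorphism_append]
          rfl
        rw [fibMorphism, hz₂]
        simpa using congrArg (· ++ (u ++ y)) this.symm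
      obtain ⟨z', hz', hr⟩ := exists_append_of_fibMorphism_eq hcut
      rcases z' with _ | ⟨_ | _, z'⟩
      · simp [fibMorphism] at hr
      · simp only [fibMorphism, List.cons.injEq, true_and] at hr
        have hlang : InFibLanguage (sw n ++ z') := by
          refine hz.of_infix ?_
          rw [hz', hs]
          simpa using (List.suffix_append z₁ (s ++ false :: z')).isInfix
        rcases sw_succ_cases (n + 1) with ⟨t', _, ht', hq', _⟩ | ⟨t', ht', hσ'⟩
        · have hrev := reverse_sw (n + 1)
          rw [ht', List.reverse_append, ← ht', hq] at hrev
          simp at hrev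
        · have hc := fibMorphism_prefix_or_prefix (ih ht' hlang)
          have : t = fibMorphism t' ++ [false] := by
            rw [hσ', ht', fibMorphism_append] at ht
            exact (List.append_inj' ht.symm rfl).1
          rw [hr, ← this] at hc
          rcases hc with hc | hc
          · exact .inl ((List.prefix_append _ _).trans hc)
          · exact List.prefix_or_prefix_of_prefix (List.prefix_append _ _) hc
      · exact absurd (by simpa [fibMorphism] using hr) (fibMorphism_ne_true_cons z' (u ++ y))
    · have h : fibMorphism z = x ++ (fibMorphism s ++ false :: false :: (u ++ y)) := by
        rw [← hxy, hσ, hs, fibMorphism_append]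
        simp [fibMorphism]
      obtain ⟨r, hr⟩ : ∃ r, fibMorphism s ++ false :: false :: (u ++ y) = false :: r := by
        rcases s with _ | ⟨_ | _, s⟩ <;> simp [fibMorphism]
      rw [hr] at h
      obtain ⟨z₁, z₂, rfl, -, hz₂⟩ := exists_cut_of_fibMorphism_eq h
      obtain ⟨z', rfl, hz'⟩ := exists_append_of_fibMorphism_eq (hz₂.trans hr.symm)
      rcases z' with _ | ⟨_ | _, z'⟩
      · simp [fibMorphism] at hz'
      · simp [fibMorphism] at hz'
      · simp only [fibMorphism, List.cons.injEq, true_and] at hz'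
        have hlang : InFibLanguage (sw n ++ z') := by
          refine hz.of_infix ?_
          rw [hs]
          simpa using (List.suffix_append z₁ (s ++ true :: z')).isInfix
        rcases sw_succ_cases (n + 1) with ⟨t', _, ht', _, hσ'⟩ | ⟨t', ht', _⟩
        · have hc := fibMorphism_prefix_or_prefix (ih ht' hlang)
          have : fibMorphism t' ++ [false] = false :: t := by
            rw [ht, ht', fibMorphism_append, ← List.cons_append] at hσ'
            refine (List.append_inj' (t₁ := [true]) (t₂ := [c]) ?_ rfl).1
            simpa [fibMorphism] using hσ'
          rw [hz', this, List.cons_prefix_cons, List.cons_prefix_cons] at hc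
          rcases hc with ⟨-, hc⟩ | ⟨-, hc⟩
          · exact .inl ((List.prefix_append _ _).trans hc)
          · exact List.prefix_or_prefix_of_prefix (List.prefix_append _ _) hc
        · rw [hσ] at ht'
          simpa using (List.append_inj' ht' rfl).2

theorem prefix_sw_succ {n : ℕ} {u : List Bool} (hu : InFibLanguage (sw n ++ u))
    (hlen : u.length < (sw (n + 1)).length) : u <+: sw (n + 1) := by
  obtain ⟨t, c, ht⟩ := (List.eq_nil_or_concat' (sw (n + 1))).resolve_left
    (List.ne_nil_of_length_pos (by omega))
  rw [ht] at hlen ⊢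
  rcases prefix_or_prefix_of_sw_append n ht hu with h | h
  · exact h.trans (List.prefix_append _ _)
  · rw [← h.eq_of_length_le (by simpa [Nat.lt_succ_iff] using hlen)]
    exact List.prefix_append _ _

theorem suffix_sw_succ {n : ℕ} {u : List Bool} (hu : InFibLanguage (u ++ sw n))
    (hlen : u.length < (sw (n + 1)).length) : u <:+ sw (n + 1) := by
  rw [← List.reverse_prefix, reverse_sw]
  refine prefix_sw_succ ?_ (by simpa using hlen)
  simpa [reverse_sw] using hu.reverse

/-- if `ω ∈ T2.2`, i.e. `ω` is a factor with `f_k < n < f_{k+1}`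
(`n = |ω|`) and `sk(ω) = s_{k-1}`, then in the kernel decomposition `ω = μ₁ s_{k-1} μ₂`
there is `0 ≤ i ≤ n - f_{k-1}` with `μ₁` the suffix of `s_k` of length `i` and
`μ₂` the prefix of `s_k` of length `n - f_{k-1} - i`. -/
theorem stmt13 (k : ℕ) (ω : List Bool) (hfac : IsFactor ω)
    (h1 : Nat.fib (k+2) < ω.length) (h2 : ω.length < Nat.fib (k+3))
    (hker : IsKernelOf (sw k) ω) :
    ∀ μ₁ μ₂ : List Bool, ω = μ₁ ++ sw k ++ μ₂ →
      ∃ i : ℕ, i ≤ ω.length - Nat.fib (k+1) ∧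
        μ₁ = (sw (k+1)).drop ((sw (k+1)).length - i) ∧
        μ₂ = (sw (k+1)).take (ω.length - Nat.fib (k+1) - i) := by
  rintro μ₁ μ₂ rfl
  have hlang := inFibLanguage_of_isFactor hfac
  have hfib : Nat.fib (k + 3) = Nat.fib (k + 1) + Nat.fib (k + 1 + 1) := Nat.fib_add_two
  simp only [List.length_append, length_sw] at h2 ⊢
  have hμ₁ : μ₁ <:+ sw (k + 1) :=
    suffix_sw_succ (hlang.of_infix (List.prefix_append _ _).isInfix)
      (by rw [length_sw]; omega)
  have hμ₂ : μ₂ <+: sw (k + 1) := by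
    refine prefix_sw_succ (hlang.of_infix ?_) (by rw [length_sw]; omega)
    rw [List.append_assoc]
    exact (List.suffix_append _ _).isInfix
  refine ⟨μ₁.length, by omega, ?_, ?_⟩
  · rw [← length_sw]
    exact List.suffix_iff_eq_drop.1 hμ₁
  · rw [show μ₁.length + Nat.fib (k + 1) + μ₂.length - Nat.fib (k + 1) - μ₁.length = μ₂.length by
      omega]
    exact List.prefix_iff_eq_take.1 hμ₂
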